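/- arXiv:2504.15511 — 5 statements merged into one kernel-verified Lean document; each statement's English description precedes it below -/
import Mathlib

section
/- Let d ≥ 2 and n ≥ 1. For any vectors v₁, v₂, …, v_{2n} ∈ ℂ^d, the Cayley first hyperdeterminant of the order-2n hypermatrix given by their iterated outer product vanishes: hdet(v₁ ∘ v₂ ∘ … ∘ v_{2n}) = 0. (In particular, the hypermatrix representation of any fully separable pure 2n-qudit state has hyperdeterminant 0.) -/
open scoped BigOperators

/-- Cayley's first hyperdeterminant of an order-`N`, side-length-`d` complex hypermatrix. -/
noncomputable def hdet {N d : ℕ} (A : (Fin N → Fin d) → ℂ) : ℂ :=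
  (1 / (Nat.factorial d : ℂ)) *
    ∑ σ : Fin N → Equiv.Perm (Fin d),
      (∏ m, ((Equiv.Perm.sign (σ m) : ℤ) : ℂ)) * ∏ j, A (fun m => (σ m) j)

/-- The hyperdeterminant of an outer product of vectors factors into determinants of matrices
with constant rows. -/
theorem hdet_outer_product {N d : ℕ} (v : Fin N → (Fin d → ℂ)) :
    hdet (fun i : Fin N → Fin d => ∏ m, v m (i m)) =
      (1 / (Nat.factorial d : ℂ)) *
        ∏ m, (Matrix.of fun i _ : Fin d => v m i).det := by
  simp only [hdet, Matrix.det_apply', Matrix.of_apply, Fintype.prod_sum]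
  congr 1
  refine Finset.sum_congr rfl fun σ _ => ?_
  rw [Finset.prod_comm, Finset.prod_mul_distrib]

/-- A square matrix of size at least two with constant rows has determinant zero. -/
theorem det_of_const_rows_eq_zero {d : ℕ} (hd : 2 ≤ d) (w : Fin d → ℂ) :
    (Matrix.of fun i _ : Fin d => w i).det = 0 :=
  Matrix.det_zero_of_column_eq (i := ⟨0, by omega⟩) (j := ⟨1, by omega⟩) (by simp) fun _ => rfl

/-- the hyperdeterminant of the outer product of `2n` vectors in `ℂ^d` vanishes. -/
theorem hdet_outer_product_of_vectors_eq_zero {d n : ℕ} (hd : 2 ≤ d) (hn : 1 ≤ n)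
    (v : Fin (2 * n) → (Fin d → ℂ)) :
    hdet (fun i : Fin (2 * n) → Fin d => ∏ m, v m (i m)) = 0 := by
  rw [hdet_outer_product,
    Finset.prod_eq_zero (Finset.mem_univ (⟨0, by omega⟩ : Fin (2 * n)))
      (det_of_const_rows_eq_zero hd _), mul_zero]
end

section
/- Let N be an even positive integer, let A be a hypermatrix of order N and side length d, and let X₁, …, X_N be d×d complex matrices. Then hdet((X₁, …, X_N) * A) = det(X₁) ⋯ det(X_N) · hdet(A). -/
open scoped BigOperators

/-- Multilinear matrix multiplication `(X₁,...,X_N) * A`. -/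
noncomputable def mlMul {N d : ℕ} (X : Fin N → Matrix (Fin d) (Fin d) ℂ)
    (A : (Fin N → Fin d) → ℂ) : (Fin N → Fin d) → ℂ :=
  fun i => ∑ j : Fin N → Fin d, (∏ m, X m (i m) (j m)) * A j

/-- Expansion of `hdet (mlMul X A)` into determinants of column selections of the `X m`. -/
theorem hdet_mlMul_eq_sum_det_submatrix {N d : ℕ} (A : (Fin N → Fin d) → ℂ)
    (X : Fin N → Matrix (Fin d) (Fin d) ℂ) :
    hdet (mlMul X A) = (1 / (Nat.factorial d : ℂ)) * ∑ f : Fin d → Fin N → Fin d,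
      (∏ m, ((X m).submatrix id fun j => f j m).det) * ∏ j, A (f j) := by
  simp only [hdet, mlMul, Matrix.det_apply', Matrix.submatrix_apply, id, Finset.prod_univ_sum,
    Fintype.piFinset_univ, Finset.mul_sum, Finset.sum_mul]
  rw [Finset.sum_comm]
  refine Finset.sum_congr rfl fun f _ => Finset.sum_congr rfl fun σ _ => ?_
  rw [Finset.prod_mul_distrib, Finset.prod_mul_distrib, Finset.prod_comm, mul_assoc]

/-- Selecting columns of a matrix scales the determinant by that of the selected columns of `1`. -/
theorem det_submatrix_id_eq_mul {n R : Type*} [Fintype n] [DecidableEq n] [CommRing R]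
    (M : Matrix n n R) (g : n → n) :
    (M.submatrix id g).det = M.det * ((1 : Matrix n n R).submatrix id g).det := by
  rw [← Matrix.det_mul]
  congr 1
  ext i j
  simp [Matrix.mul_apply, Matrix.one_apply]

/-- Multiplying by identity matrices leaves a hypermatrix unchanged. -/
theorem mlMul_one {N d : ℕ} (A : (Fin N → Fin d) → ℂ) :
    mlMul (fun _ => (1 : Matrix (Fin d) (Fin d) ℂ)) A = A := by
  ext i
  simp [mlMul, Matrix.one_apply, Finset.prod_ite_zero, ← funext_iff]

/-- for even positive order `N`,
`hdet((X₁,...,X_N) * A) = det(X₁) ⋯ det(X_N) ⋅ hdet(A)`. -/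
theorem hdet_mlMul {N d : ℕ} (hN : Even N) (hN0 : 0 < N)
    (A : (Fin N → Fin d) → ℂ) (X : Fin N → Matrix (Fin d) (Fin d) ℂ) :
    hdet (mlMul X A) = (∏ m, (X m).det) * hdet A := by
  conv_rhs => rw [← mlMul_one A]
  simp only [hdet_mlMul_eq_sum_det_submatrix]
  rw [mul_left_comm, Finset.mul_sum _ _ (∏ m, (X m).det)]
  refine congrArg _ (Finset.sum_congr rfl fun f _ => ?_)
  rw [← mul_assoc, ← Finset.prod_mul_distrib]
  simp only [← det_submatrix_id_eq_mul]
end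

section
/- Let A be a hypermatrix of even order p and side length d, and let B be a hypermatrix of even order q and side length d. Then hdet(A ∘ B) = d! · hdet(A) · hdet(B), where A ∘ B is the order-(p+q) outer product hypermatrix. -/
open scoped BigOperators

/-- The outer product of an order-`p` and an order-`q` hypermatrix of the same side length. -/
noncomputable def outer {p q d : ℕ} (A : (Fin p → Fin d) → ℂ) (B : (Fin q → Fin d) → ℂ) :
    (Fin (p + q) → Fin d) → ℂ :=
  fun i => A (fun k => i (Fin.castAdd q k)) * B (fun k => i (Fin.natAdd p k))

/-- for even orders `p`, `q`, `hdet(A ∘ B) = d! ⋅ hdet(A) ⋅ hdet(B)`. -/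
theorem hdet_outer {p q d : ℕ} (hp : Even p) (hq : Even q)
    (A : (Fin p → Fin d) → ℂ) (B : (Fin q → Fin d) → ℂ) :
    hdet (outer A B) = (Nat.factorial d : ℂ) * hdet A * hdet B := by
  have hd : (Nat.factorial d : ℂ) ≠ 0 := Nat.cast_ne_zero.mpr d.factorial_ne_zero
  unfold hdet outer
  rw [← (Fin.appendEquiv p q).sum_comp, Fintype.sum_prod_type]
  simp only [Fin.appendEquiv, Equiv.coe_fn_mk, Fin.prod_univ_add, Fin.append_left,
    Fin.append_right, Finset.prod_mul_distrib, mul_mul_mul_comm, ← Finset.sum_mul_sum]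
  field_simp
end

section
/- Cayley's first hyperdeterminant is invariant under the π-transpose: for any hypermatrix A of order N and side length d and any permutation π ∈ S_N, hdet(A^π) = hdet(A), where A^π is the hypermatrix with entries (A^π)_{i₁…i_N} = A_{i_{π(1)}…i_{π(N)}}. -/
open scoped BigOperators

/-- `hdet` is invariant under the π-transpose
`(A^π)_{i₁…i_N} = A_{i_{π(1)}…i_{π(N)}}`. -/
theorem hdet_pi_transpose {N d : ℕ} (A : (Fin N → Fin d) → ℂ) (π : Equiv.Perm (Fin N)) :
    hdet (fun i : Fin N → Fin d => A (fun m => i (π m))) = hdet A := by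
  unfold hdet
  congr 1
  refine Fintype.sum_equiv (Equiv.arrowCongr π.symm (Equiv.refl _)) _ _ fun σ => ?_
  congr 1
  exact (Equiv.prod_comp π fun m => ((Equiv.Perm.sign (σ m) : ℤ) : ℂ)).symm
end

section
/- Let M₁ and M₂ be d×d complex matrices satisfying M₁†M₁ + M₂†M₂ = I_d. Then there exist d×d unitary matrices U₁, U₂, V and real numbers σ₁, …, σ_d ∈ [0, 1] such that M₁ = U₁ · diag(σ₁, …, σ_d) · V† and M₂ = U₂ · diag(√(1−σ₁²), …, √(1−σ_d²)) · V†; in particular M₁ and M₂ admit singular value decompositions with the same matrix of right singular vectors. -/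
open scoped BigOperators
open Matrix

open scoped ComplexOrder in
/-- A square matrix whose Gram matrix is diagonal with entries `s k ^ 2` is a unitary matrix
times the diagonal matrix of the `s k`. -/
theorem exists_unitary_mul_diagonal_of_conjTranspose_mul_self {n : Type*} [Fintype n]
    [DecidableEq n] (N : Matrix n n ℂ) (s : n → ℝ)
    (h : Nᴴ * N = diagonal fun k => (s k : ℂ) ^ 2) :
    ∃ U ∈ unitaryGroup n ℂ, N = U * diagonal fun k => (s k : ℂ) := by
  have hcol (j k : n) : ∑ i, star (N i j) * N i k = if j = k then (s j : ℂ) ^ 2 else 0 := by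
    simpa [mul_apply, diagonal_apply] using congrFun (congrFun h j) k
  let v : n → EuclideanSpace ℂ n := fun k => WithLp.toLp 2 fun i => (s k : ℂ)⁻¹ * N i k
  have hv : Orthonormal ℂ ({k | s k ≠ 0}.domRestrict v) := by
    rw [orthonormal_iff_ite]
    rintro ⟨j, hj⟩ ⟨k, hk⟩
    have hj' : (s j : ℂ) ≠ 0 := by exact_mod_cast hj
    have hinner : inner ℂ (v j) (v k) =
        (s j : ℂ)⁻¹ * (s k : ℂ)⁻¹ * ∑ i, star (N i j) * N i k := by
      simp only [v, PiLp.inner_apply, RCLike.inner_apply, Finset.mul_sum]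
      refine Finset.sum_congr rfl fun i _ => ?_
      simp only [map_mul, map_inv₀, Complex.conj_ofReal, ← starRingEnd_apply]
      ring
    rw [Set.domRestrict_apply, Set.domRestrict_apply, hinner, hcol]
    simp only [Subtype.mk.injEq]
    split_ifs with hjk
    · subst hjk
      field_simp
    · simp
  obtain ⟨b, hb⟩ := hv.exists_orthonormalBasis_extension_of_card_eq (by simp)
  refine ⟨Matrix.of fun i k => b k i, ?_, ?_⟩
  · rw [mem_unitaryGroup_iff']
    ext j k
    have := orthonormal_iff_ite.mp b.orthonormal j k
    simpa [mul_apply, one_apply, PiLp.inner_apply, mul_comm] using this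
  · ext i k
    rw [mul_diagonal, of_apply]
    by_cases hk : s k = 0
    · have h0 : N.col k = 0 := by
        rw [← dotProduct_star_self_eq_zero]
        simpa [dotProduct, hk, mul_comm] using hcol k k
      simpa [hk] using congrFun h0 i
    · have hk' : (s k : ℂ) ≠ 0 := by exact_mod_cast hk
      rw [hb k hk]
      simp only [v]
      field_simp

/-- two matrices forming a two-outcome POVM admit singular value decompositions
with the same matrix of right singular vectors, with singular values `σ_k ∈ [0,1]` and
`√(1 − σ_k²)` respectively. -/
theorem povm_simultaneous_svd {d : ℕ} (M₁ M₂ : Matrix (Fin d) (Fin d) ℂ)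
    (hPOVM : M₁ᴴ * M₁ + M₂ᴴ * M₂ = 1) :
    ∃ (U₁ U₂ V : Matrix (Fin d) (Fin d) ℂ) (σ : Fin d → ℝ),
      U₁ ∈ Matrix.unitaryGroup (Fin d) ℂ ∧
      U₂ ∈ Matrix.unitaryGroup (Fin d) ℂ ∧
      V ∈ Matrix.unitaryGroup (Fin d) ℂ ∧
      (∀ k, σ k ∈ Set.Icc (0 : ℝ) 1) ∧
      M₁ = U₁ * Matrix.diagonal (fun k => (σ k : ℂ)) * Vᴴ ∧
      M₂ = U₂ * Matrix.diagonal (fun k => (Real.sqrt (1 - σ k ^ 2) : ℂ)) * Vᴴ := by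
  have hA : (M₁ᴴ * M₁).IsHermitian := isHermitian_conjTranspose_mul_self M₁
  let V : Matrix (Fin d) (Fin d) ℂ := hA.eigenvectorUnitary
  have hV : V ∈ unitaryGroup (Fin d) ℂ := hA.eigenvectorUnitary.2
  have hVV : Vᴴ * V = 1 := mem_unitaryGroup_iff'.mp hV
  have hVV' : V * Vᴴ = 1 := mem_unitaryGroup_iff.mp hV
  let e : Fin d → ℝ := hA.eigenvalues
  have hspec : M₁ᴴ * M₁ = V * diagonal (fun k => (e k : ℂ)) * Vᴴ := hA.spectral_theorem
  have h₁ : (M₁ * V)ᴴ * (M₁ * V) = diagonal fun k => (e k : ℂ) := by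
    calc (M₁ * V)ᴴ * (M₁ * V) = Vᴴ * (M₁ᴴ * M₁) * V := by
          simp only [conjTranspose_mul, Matrix.mul_assoc]
      _ = (Vᴴ * V) * diagonal (fun k => (e k : ℂ)) * (Vᴴ * V) := by
          rw [hspec]; simp only [Matrix.mul_assoc]
      _ = _ := by simp [hVV]
  have h₂ : (M₂ * V)ᴴ * (M₂ * V) = diagonal fun k => ((1 - e k : ℝ) : ℂ) := by
    calc (M₂ * V)ᴴ * (M₂ * V) = Vᴴ * (M₁ᴴ * M₁ + M₂ᴴ * M₂) * V - (M₁ * V)ᴴ * (M₁ * V) := by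
          simp only [conjTranspose_mul, Matrix.mul_assoc, Matrix.mul_add, Matrix.add_mul]
          abel
      _ = 1 - diagonal fun k => (e k : ℂ) := by rw [hPOVM, h₁, Matrix.mul_one, hVV]
      _ = _ := by rw [← diagonal_one, diagonal_sub]; simp
  have he₀ (k : Fin d) : 0 ≤ e k :=
    open scoped ComplexOrder in (posSemidef_conjTranspose_mul_self M₁).eigenvalues_nonneg k
  have he₁ (k : Fin d) : 0 ≤ 1 - e k := by
    open scoped ComplexOrder in
    have := (posSemidef_conjTranspose_mul_self (M₂ * V)).diag_nonneg (i := k)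
    rw [h₂, diagonal_apply_eq, Complex.zero_le_real] at this
    exact this
  obtain ⟨U₁, hU₁, hM₁⟩ := exists_unitary_mul_diagonal_of_conjTranspose_mul_self (M₁ * V)
    (fun k => √(e k)) (by simp only [h₁, ← Complex.ofReal_pow, Real.sq_sqrt (he₀ _)])
  obtain ⟨U₂, hU₂, hM₂⟩ := exists_unitary_mul_diagonal_of_conjTranspose_mul_self (M₂ * V)
    (fun k => √(1 - e k)) (by simp only [h₂, ← Complex.ofReal_pow, Real.sq_sqrt (he₁ _)])
  refine ⟨U₁, U₂, V, fun k => √(e k), hU₁, hU₂, hV, fun k => ⟨Real.sqrt_nonneg _, ?_⟩, ?_, ?_⟩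
  · exact Real.sqrt_le_one.mpr (sub_nonneg.mp (he₁ k))
  · rw [← hM₁, Matrix.mul_assoc, hVV', Matrix.mul_one]
  · simp only [Real.sq_sqrt (he₀ _)]
    rw [← hM₂, Matrix.mul_assoc, hVV', Matrix.mul_one]
end
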